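/- arXiv:1311.5175 — 3 statements merged into one kernel-verified Lean document; each statement's English description precedes it below -/
import Mathlib

section
/- Let ρ, c₀, ε̃₀, χ₁, g be as below, and let δ̃₀ > 0 be such that the three lower bounds for 2 Re g(w, z) hold for ρ(w) < c₀ and ρ(z) < 2δ̃₀. For j = 1, …, n set Δⱼ(w, z) = (∂ρ/∂ζⱼ)(w) − (1/2) Σₖ (∂²ρ/∂ζⱼ∂ζₖ)(w)(wₖ − zₖ) and ηⱼ(w, z) = (χ₁(w, z)Δⱼ(w, z) + (1 − χ₁(w, z))(w̄ⱼ − z̄ⱼ)) / g(w, z). Then for every z ∈ D, setting U_z = {w : max{ρ(z), −δ̃₀} < ρ(w) < min{−ρ(z), c₀}}, one has: U_z is open, bD ⊂ U_z, z ∉ U_z, Re g(w, z) > 0 for every w ∈ U_z (so ηⱼ(·, z) is well defined and continuous on U_z), and Σ_{j=1}ⁿ ηⱼ(w, z)(wⱼ − zⱼ) = 1 for every w ∈ U_z; that is, η = Σⱼ ηⱼ dwⱼ is a generating form for D. -/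
open MeasureTheory Complex

noncomputable section

/-- ℂⁿ with the Euclidean norm. -/
abbrev Cn (n : ℕ) := EuclideanSpace ℂ (Fin n)

instance (n : ℕ) : MeasurableSpace (Cn n) := borel _
instance (n : ℕ) : BorelSpace (Cn n) := ⟨rfl⟩

/-- Wirtinger derivative ∂f/∂ζⱼ of `f : ℂⁿ → ℂ` at `w`. -/
def wderiv {n : ℕ} (f : Cn n → ℂ) (w : Cn n) (j : Fin n) : ℂ :=
  (1/2) * (fderiv ℝ f w (EuclideanSpace.single j (1:ℂ))
            - Complex.I * fderiv ℝ f w (EuclideanSpace.single j Complex.I))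

/-- Conjugate Wirtinger derivative ∂f/∂ζ̄ⱼ of `f : ℂⁿ → ℂ` at `w`. -/
def wderivBar {n : ℕ} (f : Cn n → ℂ) (w : Cn n) (j : Fin n) : ℂ :=
  (1/2) * (fderiv ℝ f w (EuclideanSpace.single j (1:ℂ))
            + Complex.I * fderiv ℝ f w (EuclideanSpace.single j Complex.I))

/-- A real-valued function regarded as complex valued. -/
def realToC {n : ℕ} (ρ : Cn n → ℝ) : Cn n → ℂ := fun w => (ρ w : ℂ)

/-- ⟨∂ρ(w), ξ⟩ = Σⱼ (∂ρ/∂ζⱼ)(w) ξⱼ. -/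
def delPair {n : ℕ} (ρ : Cn n → ℝ) (w ξ : Cn n) : ℂ :=
  ∑ j, wderiv (realToC ρ) w j * ξ j

/-- Second Wirtinger derivative ∂²ρ/∂ζⱼ∂ζₖ. -/
def wderiv2 {n : ℕ} (ρ : Cn n → ℝ) (w : Cn n) (j k : Fin n) : ℂ :=
  wderiv (fun v => wderiv (realToC ρ) v j) w k

/-- The Levi form L_w(ρ)(ξ) = Σ_{j,k} (∂²ρ/∂ζⱼ∂ζ̄ₖ)(w) ξⱼ ξ̄ₖ (a real number). -/
def leviForm {n : ℕ} (ρ : Cn n → ℝ) (w ξ : Cn n) : ℝ :=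
  (∑ j, ∑ k, wderivBar (fun v => wderiv (realToC ρ) v j) w k * ξ j * (starRingEnd ℂ) (ξ k)).re

/-- Surface measure σ on bD: (2n−1)-dimensional Hausdorff measure restricted to the boundary. -/
def bSigma {n : ℕ} (D : Set (Cn n)) : Measure (Cn n) :=
  (μH[(2*(n:ℝ) - 1)]).restrict (frontier D)

/-- Lebesgue measure dV on ℂⁿ ≅ ℝ²ⁿ, realized as 2n-dimensional Hausdorff measure. -/
def dVol (n : ℕ) : Measure (Cn n) := μH[(2*(n:ℝ))]

/-- The Levi polynomial Δ(w,z) of ρ at w. -/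
def leviPoly {n : ℕ} (ρ : Cn n → ℝ) (w z : Cn n) : ℂ :=
  delPair ρ w (w - z) - (1/2) * ∑ j, ∑ k, wderiv2 ρ w j k * (w j - z j) * (w k - z k)

/-- g(w,z) = χ₁(w,z)·Δ(w,z) + (1 − χ₁(w,z))·|w−z|². -/
def gcut {n : ℕ} (ρ : Cn n → ℝ) (χ₁ : Cn n × Cn n → ℝ) (w z : Cn n) : ℂ :=
  (χ₁ (w, z) : ℂ) * leviPoly ρ w z + ((1 - χ₁ (w, z) : ℝ) : ℂ) * ((‖w - z‖ ^ 2 : ℝ) : ℂ)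

/-- Δⱼ(w,z) = (∂ρ/∂ζⱼ)(w) − (1/2) Σₖ (∂²ρ/∂ζⱼ∂ζₖ)(w)(wₖ−zₖ). -/
def leviPolyJ {n : ℕ} (ρ : Cn n → ℝ) (w z : Cn n) (j : Fin n) : ℂ :=
  wderiv (realToC ρ) w j - (1/2) * ∑ k, wderiv2 ρ w j k * (w k - z k)

/-- The coefficients ηⱼ(w,z) of the glued generating form. -/
def etaJ {n : ℕ} (ρ : Cn n → ℝ) (χ₁ : Cn n × Cn n → ℝ) (w z : Cn n) (j : Fin n) : ℂ :=
  ((χ₁ (w, z) : ℂ) * leviPolyJ ρ w z j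
    + ((1 - χ₁ (w, z) : ℝ) : ℂ) * (starRingEnd ℂ) (w j - z j)) / gcut ρ χ₁ w z

theorem wderiv_contDiff_aux {n : ℕ} (f : Cn n → ℂ) (m k : WithTop ℕ∞) (hmk : m + 1 ≤ k)
    (hf : ContDiff ℝ k f) (j : Fin n) : ContDiff ℝ m (fun w => wderiv f w j) := by
  have h := hf.fderiv_right hmk
  unfold wderiv
  exact contDiff_const.mul ((h.clm_apply contDiff_const).sub
    (contDiff_const.mul (h.clm_apply contDiff_const)))

theorem sum_aux {n : ℕ} (ρ : Cn n → ℝ) (χ₁ : Cn n × Cn n → ℝ) (w z : Cn n) :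
    ∑ j, ((χ₁ (w, z) : ℂ) * leviPolyJ ρ w z j
      + ((1 - χ₁ (w, z) : ℝ) : ℂ) * (starRingEnd ℂ) (w j - z j)) * (w j - z j)
      = gcut ρ χ₁ w z := by
  have h1 : ∑ j, leviPolyJ ρ w z j * (w j - z j) = leviPoly ρ w z := by
    unfold leviPolyJ leviPoly delPair
    rw [Finset.mul_sum, ← Finset.sum_sub_distrib]
    refine Finset.sum_congr rfl fun j _ => ?_
    have : ∑ k, wderiv2 ρ w j k * (w j - z j) * (w k - z k)
        = (∑ k, wderiv2 ρ w j k * (w k - z k)) * (w j - z j) := by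
      rw [Finset.sum_mul]
      exact Finset.sum_congr rfl fun k _ => by ring
    rw [this, PiLp.sub_apply]
    ring
  have h2 : ∑ j, (starRingEnd ℂ) (w j - z j) * (w j - z j) = ((‖w - z‖ ^ 2 : ℝ) : ℂ) := by
    rw [EuclideanSpace.norm_sq_eq, Complex.ofReal_sum]
    refine Finset.sum_congr rfl fun j _ => ?_
    rw [Complex.conj_mul', PiLp.sub_apply, Complex.ofReal_pow]
  unfold gcut
  rw [← h1, ← h2, Finset.mul_sum, Finset.mul_sum, ← Finset.sum_add_distrib]
  exact Finset.sum_congr rfl fun j _ => by ring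

/-- The glued form `η = Σⱼ ηⱼ dwⱼ` is a generating form for
`D = {ρ < 0}`. -/
theorem etaJ_generating
    {n : ℕ} (ρ : Cn n → ℝ) (hρ : ContDiff ℝ 2 ρ)
    (hne : {w : Cn n | ρ w < 0}.Nonempty)
    (hb : Bornology.IsBounded {w : Cn n | ρ w < 0})
    (hgrad : ∀ w ∈ frontier {w : Cn n | ρ w < 0}, fderiv ℝ ρ w ≠ 0)
    (c₀ : ℝ) (hc₀ : 0 < c₀)
    (hlevi : ∀ w ξ : Cn n, 2 * c₀ * ‖ξ‖ ^ 2 ≤ leviForm ρ w ξ)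
    (ε₀ : ℝ) (hε₀ : 0 < ε₀)
    (hΔ : ∀ w z : Cn n, ρ w < c₀ → ‖w - z‖ ≤ ε₀ →
      ρ w - ρ z + c₀ * ‖w - z‖ ^ 2 ≤ 2 * (leviPoly ρ w z).re)
    (χ₁ : Cn n × Cn n → ℝ) (hχsm : ContDiff ℝ (⊤ : ℕ∞) χ₁)
    (hχ01 : ∀ q : Cn n × Cn n, χ₁ q ∈ Set.Icc (0:ℝ) 1)
    (hχ1 : ∀ w z : Cn n, ‖w - z‖ < ε₀ / 2 → χ₁ (w, z) = 1)
    (hχ0 : ∀ w z : Cn n, ε₀ < ‖w - z‖ → χ₁ (w, z) = 0)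
    (δ₀ : ℝ) (hδ₀ : 0 < δ₀)
    (hg : ∀ w z : Cn n, ρ w < c₀ → ρ z < 2 * δ₀ →
      (‖w - z‖ ≤ ε₀ / 2 →
        ρ w - ρ z + c₀ * ‖w - z‖ ^ 2 ≤ 2 * (gcut ρ χ₁ w z).re) ∧
      (ε₀ / 2 ≤ ‖w - z‖ → ‖w - z‖ < ε₀ →
        ρ w + 2 * δ₀ ≤ 2 * (gcut ρ χ₁ w z).re) ∧
      (ε₀ ≤ ‖w - z‖ → ε₀ ^ 2 ≤ 2 * (gcut ρ χ₁ w z).re)) :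
    ∀ z : Cn n, ρ z < 0 →
      ∀ Uz : Set (Cn n),
        Uz = {w : Cn n | max (ρ z) (-δ₀) < ρ w ∧ ρ w < min (-(ρ z)) c₀} →
        IsOpen Uz ∧
        frontier {w : Cn n | ρ w < 0} ⊆ Uz ∧
        z ∉ Uz ∧
        (∀ w ∈ Uz, 0 < (gcut ρ χ₁ w z).re) ∧
        (∀ j : Fin n, ContinuousOn (fun w => etaJ ρ χ₁ w z j) Uz) ∧
        (∀ w ∈ Uz, ∑ j, etaJ ρ χ₁ w z j * (w j - z j) = 1) := by
  intro z hz Uz hU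
  have hc := hρ.continuous
  have hpos : ∀ w ∈ Uz, 0 < (gcut ρ χ₁ w z).re := by
    intro w hw
    rw [hU] at hw
    obtain ⟨h1, h2⟩ := hw
    obtain ⟨h1a, h1b⟩ := max_lt_iff.1 h1
    obtain ⟨h2a, h2b⟩ := lt_min_iff.1 h2
    obtain ⟨ga, gb, gc⟩ := hg w z h2b (by linarith)
    rcases le_or_gt ‖w - z‖ (ε₀ / 2) with h | h
    · have := ga h
      have : 0 ≤ c₀ * ‖w - z‖ ^ 2 := by positivity
      linarith
    · rcases lt_or_ge ‖w - z‖ ε₀ with h' | h'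
      · have := gb h.le h'
        linarith
      · have := gc h'
        have : 0 < ε₀ ^ 2 := by positivity
        linarith
  have hne0 : ∀ w ∈ Uz, gcut ρ χ₁ w z ≠ 0 := by
    intro w hw h0
    have := hpos w hw
    rw [h0] at this
    simp at this
  refine ⟨?_, ?_, ?_, hpos, ?_, ?_⟩
  · rw [hU]
    exact (isOpen_lt continuous_const hc).inter (isOpen_lt hc continuous_const)
  · intro w hw
    have h0 : ρ w = 0 := frontier_lt_subset_eq hc continuous_const hw
    rw [hU]
    refine ⟨?_, ?_⟩
    · rw [h0]
      exact max_lt hz (by linarith)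
    · rw [h0]
      exact lt_min (by linarith) hc₀
  · intro h
    rw [hU] at h
    exact lt_irrefl _ ((le_max_left _ _).trans_lt h.1)
  · intro j
    have hρC : ContDiff ℝ 2 (realToC ρ) := Complex.ofRealCLM.contDiff.comp hρ
    have d1 : ∀ j, ContDiff ℝ 1 (fun w => wderiv (realToC ρ) w j) := fun j =>
      wderiv_contDiff_aux _ 1 2 (by norm_num) hρC j
    have c1 : ∀ j, Continuous (fun w => wderiv (realToC ρ) w j) := fun j => (d1 j).continuous
    have c2 : ∀ j k, Continuous (fun w => wderiv2 ρ w j k) := fun j k =>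
      (wderiv_contDiff_aux _ 0 1 (by norm_num) (d1 j) k).continuous
    have cχ : Continuous (fun w => χ₁ (w, z)) :=
      hχsm.continuous.comp (continuous_id.prodMk continuous_const)
    have cJ : ∀ j, Continuous (fun w => leviPolyJ ρ w z j) := by
      intro j
      unfold leviPolyJ
      exact (c1 j).sub (continuous_const.mul (continuous_finsetSum _ fun k _ =>
        (c2 j k).mul (by fun_prop)))
    have cN : ∀ j, Continuous (fun w : Cn n => (χ₁ (w, z) : ℂ) * leviPolyJ ρ w z j
        + ((1 - χ₁ (w, z) : ℝ) : ℂ) * (starRingEnd ℂ) (w j - z j)) := by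
      intro j
      have cj : Continuous (fun w : Cn n => w j - z j) := by fun_prop
      exact ((Complex.continuous_ofReal.comp cχ).mul (cJ j)).add
        ((Complex.continuous_ofReal.comp (continuous_const.sub cχ)).mul
          (Complex.continuous_conj.comp cj))
    have cg : Continuous (fun w => gcut ρ χ₁ w z) := by
      simp_rw [← sum_aux]
      exact continuous_finsetSum _ fun k _ => (cN k).mul (by fun_prop)
    exact (cN j).continuousOn.div cg.continuousOn hne0
  · intro w hw
    have := sum_aux ρ χ₁ w z
    unfold etaJ
    simp_rw [div_mul_eq_mul_div]
    rw [← Finset.sum_div, this, div_self (hne0 w hw)]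

end
end

section
/- Let z ∈ ℂ², let U ⊆ ℂ²∖{z} be open, and let η₁, η₂ : U → ℂ be of class C¹ (as functions of the underlying real coordinates) with η₁(w)(w₁ − z₁) + η₂(w)(w₂ − z₂) = 1 for all w ∈ U. Then for every w ∈ U: (∂η₁/∂w̄₁)(w)·(∂η₂/∂w̄₂)(w) − (∂η₁/∂w̄₂)(w)·(∂η₂/∂w̄₁)(w) = 0. (Equivalently, (∂̄_w η)² = 0 on U for the (1,0)-form η = η₁ dw₁ + η₂ dw₂, which is Basic Property 2 of Cauchy–Fantappiè theory in dimension n = 2.) -/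
open MeasureTheory Complex

noncomputable section

/-- ∂f/∂w̄₁ for f : ℂ² → ℂ. -/
def dbarFst (f : ℂ × ℂ → ℂ) (w : ℂ × ℂ) : ℂ :=
  (1/2) * (fderiv ℝ f w ((1:ℂ), (0:ℂ)) + Complex.I * fderiv ℝ f w (Complex.I, (0:ℂ)))

/-- ∂f/∂w̄₂ for f : ℂ² → ℂ. -/
def dbarSnd (f : ℂ × ℂ → ℂ) (w : ℂ × ℂ) : ℂ :=
  (1/2) * (fderiv ℝ f w ((0:ℂ), (1:ℂ)) + Complex.I * fderiv ℝ f w ((0:ℂ), Complex.I))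

/-- If `η = η₁ dw₁ + η₂ dw₂` is a `C¹` generating form at `z` on
`U ⊆ ℂ²∖{z}`, then `(∂̄η)² = 0` on `U`, i.e. the 2×2 antiholomorphic Jacobian
determinant of `(η₁, η₂)` vanishes. -/
theorem dbar_eta_squared_zero
    (z : ℂ × ℂ) (U : Set (ℂ × ℂ)) (hU : IsOpen U) (hz : z ∉ U)
    (η₁ η₂ : ℂ × ℂ → ℂ)
    (h1 : ContDiffOn ℝ 1 η₁ U) (h2 : ContDiffOn ℝ 1 η₂ U)
    (hgen : ∀ w ∈ U, η₁ w * (w.1 - z.1) + η₂ w * (w.2 - z.2) = 1) :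
    ∀ w ∈ U,
      dbarFst η₁ w * dbarSnd η₂ w - dbarSnd η₁ w * dbarFst η₂ w = 0 := by
  intro w hw
  have d1 : DifferentiableAt ℝ η₁ w :=
    (h1.contDiffAt (hU.mem_nhds hw)).differentiableAt one_ne_zero
  have d2 : DifferentiableAt ℝ η₂ w :=
    (h2.contDiffAt (hU.mem_nhds hw)).differentiableAt one_ne_zero
  have e1 : HasFDerivAt (fun w : ℂ × ℂ => w.1 - z.1) (ContinuousLinearMap.fst ℝ ℂ ℂ) w :=
    hasFDerivAt_fst.sub_const _
  have e2 : HasFDerivAt (fun w : ℂ × ℂ => w.2 - z.2) (ContinuousLinearMap.snd ℝ ℂ ℂ) w :=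
    hasFDerivAt_snd.sub_const _
  have H := (d1.hasFDerivAt.mul e1).add (d2.hasFDerivAt.mul e2)
  have H0 : HasFDerivAt (fun _ : ℂ × ℂ => (1 : ℂ)) (0 : ℂ × ℂ →L[ℝ] ℂ) w :=
    hasFDerivAt_const _ _
  have H1 := H0.congr_of_eventuallyEq
    (Filter.eventuallyEq_of_mem (hU.mem_nhds hw) (fun v hv => hgen v hv))
  have key := H.unique H1
  have kv : ∀ v : ℂ × ℂ, η₁ w * v.1 + (w.1 - z.1) * fderiv ℝ η₁ w v
      + (η₂ w * v.2 + (w.2 - z.2) * fderiv ℝ η₂ w v) = 0 := by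
    intro v
    have := congrArg (fun L : ℂ × ℂ →L[ℝ] ℂ => L v) key
    simpa using this
  have k1 : (w.1 - z.1) * dbarFst η₁ w + (w.2 - z.2) * dbarFst η₂ w = 0 := by
    have a := kv (1, 0)
    have b := kv (Complex.I, 0)
    simp only [dbarFst] at *
    linear_combination (1/2) * a + (1/2) * Complex.I * b - (1/2) * η₁ w * Complex.I_mul_I
  have k2 : (w.1 - z.1) * dbarSnd η₁ w + (w.2 - z.2) * dbarSnd η₂ w = 0 := by
    have a := kv (0, 1)
    have b := kv (0, Complex.I)
    simp only [dbarSnd] at *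
    linear_combination (1/2) * a + (1/2) * Complex.I * b - (1/2) * η₂ w * Complex.I_mul_I
  have g := hgen w hw
  linear_combination (-(dbarFst η₁ w * dbarSnd η₂ w - dbarSnd η₁ w * dbarFst η₂ w)) * g
    + η₁ w * (dbarSnd η₂ w * k1 - dbarFst η₂ w * k2)
    + η₂ w * (dbarFst η₁ w * k2 - dbarSnd η₁ w * k1)

end
end

section
/- Let W ⊆ ℂ² × ℂ² be an open set with w ≠ z for every (w, z) ∈ W, and let η₁, η₂ : W → ℂ be of class C¹ (as functions of the underlying real coordinates) with η₁(w, z)(w₁ − z₁) + η₂(w, z)(w₂ − z₂) = 1 for all (w, z) ∈ W. Then for every (w, z) ∈ W and all j, k ∈ {1, 2}: (∂η₁/∂w̄ⱼ)(w, z)·(∂η₂/∂z̄ₖ)(w, z) = (∂η₂/∂w̄ⱼ)(w, z)·(∂η₁/∂z̄ₖ)(w, z). (Equivalently, ∂̄_w η ∧ ∂̄_z η = 0 on W for η = η₁ dw₁ + η₂ dw₂, the key identity in the proof of Basic Property 3 of Cauchy–Fantappiè theory in dimension n = 2.) -/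
open MeasureTheory Complex

noncomputable section

/-- ∂f/∂w̄ⱼ for f : ℂ² × ℂ² → ℂ (derivative in the first group of variables). -/
def dbarW (j : Fin 2) (f : (ℂ × ℂ) × (ℂ × ℂ) → ℂ) (p : (ℂ × ℂ) × (ℂ × ℂ)) : ℂ :=
  if j = 0 then
    (1/2) * (fderiv ℝ f p (((1:ℂ), (0:ℂ)), ((0:ℂ), (0:ℂ)))
      + Complex.I * fderiv ℝ f p ((Complex.I, (0:ℂ)), ((0:ℂ), (0:ℂ))))
  else
    (1/2) * (fderiv ℝ f p (((0:ℂ), (1:ℂ)), ((0:ℂ), (0:ℂ)))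
      + Complex.I * fderiv ℝ f p (((0:ℂ), Complex.I), ((0:ℂ), (0:ℂ))))

/-- ∂f/∂z̄ₖ for f : ℂ² × ℂ² → ℂ (derivative in the second group of variables). -/
def dbarZ (k : Fin 2) (f : (ℂ × ℂ) × (ℂ × ℂ) → ℂ) (p : (ℂ × ℂ) × (ℂ × ℂ)) : ℂ :=
  if k = 0 then
    (1/2) * (fderiv ℝ f p (((0:ℂ), (0:ℂ)), ((1:ℂ), (0:ℂ)))
      + Complex.I * fderiv ℝ f p (((0:ℂ), (0:ℂ)), (Complex.I, (0:ℂ))))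
  else
    (1/2) * (fderiv ℝ f p (((0:ℂ), (0:ℂ)), ((0:ℂ), (1:ℂ)))
      + Complex.I * fderiv ℝ f p (((0:ℂ), (0:ℂ)), ((0:ℂ), Complex.I)))

/-- For a `C¹` generating form in two variables,
`∂̄_w η ∧ ∂̄_z η = 0`: in coordinates,
`(∂η₁/∂w̄ⱼ)(∂η₂/∂z̄ₖ) = (∂η₂/∂w̄ⱼ)(∂η₁/∂z̄ₖ)` for all `j, k`. -/
theorem dbarW_dbarZ_identity
    (W : Set ((ℂ × ℂ) × (ℂ × ℂ))) (hWo : IsOpen W)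
    (hWne : ∀ p ∈ W, p.1 ≠ p.2)
    (η₁ η₂ : (ℂ × ℂ) × (ℂ × ℂ) → ℂ)
    (h1 : ContDiffOn ℝ 1 η₁ W) (h2 : ContDiffOn ℝ 1 η₂ W)
    (hgen : ∀ p ∈ W,
      η₁ p * (p.1.1 - p.2.1) + η₂ p * (p.1.2 - p.2.2) = 1) :
    ∀ p ∈ W, ∀ j k : Fin 2,
      dbarW j η₁ p * dbarZ k η₂ p = dbarW j η₂ p * dbarZ k η₁ p := by
  intro p hp j k
  have d1 : HasFDerivAt η₁ (fderiv ℝ η₁ p) p :=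
    ((h1.contDiffAt (hWo.mem_nhds hp)).differentiableAt (by norm_num)).hasFDerivAt
  have d2 : HasFDerivAt η₂ (fderiv ℝ η₂ p) p :=
    ((h2.contDiffAt (hWo.mem_nhds hp)).differentiableAt (by norm_num)).hasFDerivAt
  let L1 : ((ℂ × ℂ) × (ℂ × ℂ)) →L[ℝ] ℂ :=
    (ContinuousLinearMap.fst ℝ ℂ ℂ).comp (ContinuousLinearMap.fst ℝ (ℂ × ℂ) (ℂ × ℂ))
    - (ContinuousLinearMap.fst ℝ ℂ ℂ).comp (ContinuousLinearMap.snd ℝ (ℂ × ℂ) (ℂ × ℂ))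
  let L2 : ((ℂ × ℂ) × (ℂ × ℂ)) →L[ℝ] ℂ :=
    (ContinuousLinearMap.snd ℝ ℂ ℂ).comp (ContinuousLinearMap.fst ℝ (ℂ × ℂ) (ℂ × ℂ))
    - (ContinuousLinearMap.snd ℝ ℂ ℂ).comp (ContinuousLinearMap.snd ℝ (ℂ × ℂ) (ℂ × ℂ))
  have hs := (d1.mul (L1.hasFDerivAt (x := p))).add (d2.mul (L2.hasFDerivAt (x := p)))
  have hc : HasFDerivAt (fun _ : (ℂ × ℂ) × (ℂ × ℂ) => (1 : ℂ))
      (0 : ((ℂ × ℂ) × (ℂ × ℂ)) →L[ℝ] ℂ) p := hasFDerivAt_const _ _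
  have hE := hs.unique (hc.congr_of_eventuallyEq (by
    filter_upwards [hWo.mem_nhds hp] with q hq
    exact hgen q hq))
  have key : ∀ v : (ℂ × ℂ) × (ℂ × ℂ),
      η₁ p * (v.1.1 - v.2.1) + (p.1.1 - p.2.1) * fderiv ℝ η₁ p v
      + (η₂ p * (v.1.2 - v.2.2) + (p.1.2 - p.2.2) * fderiv ℝ η₂ p v) = 0 := by
    intro v
    exact DFunLike.congr_fun hE v
  have hw : (p.1.1 - p.2.1) * dbarW j η₁ p + (p.1.2 - p.2.2) * dbarW j η₂ p = 0 := by
    unfold dbarW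
    split_ifs
    · have a := key ((1, 0), (0, 0))
      have b := key ((I, 0), (0, 0))
      simp only at a b
      linear_combination (1/2) * a + (1/2) * I * b - (1/2) * η₁ p * I_sq
    · have a := key ((0, 1), (0, 0))
      have b := key ((0, I), (0, 0))
      simp only at a b
      linear_combination (1/2) * a + (1/2) * I * b - (1/2) * η₂ p * I_sq
  have hz : (p.1.1 - p.2.1) * dbarZ k η₁ p + (p.1.2 - p.2.2) * dbarZ k η₂ p = 0 := by
    unfold dbarZ
    split_ifs
    · have a := key ((0, 0), (1, 0))
      have b := key ((0, 0), (I, 0))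
      simp only at a b
      linear_combination (1/2) * a + (1/2) * I * b + (1/2) * η₁ p * I_sq
    · have a := key ((0, 0), (0, 1))
      have b := key ((0, 0), (0, I))
      simp only at a b
      linear_combination (1/2) * a + (1/2) * I * b + (1/2) * η₂ p * I_sq
  have hg := hgen p hp
  generalize dbarW j η₁ p = A at *
  generalize dbarW j η₂ p = B at *
  generalize dbarZ k η₁ p = C at *
  generalize dbarZ k η₂ p = D at *
  linear_combination (B * C - A * D) * hg + (η₁ p * D - η₂ p * C) * hw
    + (η₂ p * A - η₁ p * B) * hz

end
end
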